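/- If a bipartite graph G has 1-expansion up to K, then G has dynamic matching up to K with load 3. -/

import Mathlib

/-!
Bipartite graphs are modelled by a neighborhood function `Nbr : L → Finset R`
on finite types `L` (left nodes) and `R` (right nodes).

The dynamic matching game with parameters `K` and `ℓ` (the load):
Requester and Matcher maintain a set `M` of edges, initially empty, and alternate
turns with Requester first.  At round `n`, Requester removes a set of edges from `M`
(so that afterwards `#M ≤ K - 1`) and selects a left node; Matcher replies, according
to her strategy, by adding one edge of the graph incident on the selected node,
and afterwards every right node must be incident on at most `ℓ` edges of `M`.
A strategy is winning if against every legal play of Requester all these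
conditions always hold.
-/

namespace DM

/-- A Requester move: a set of edges to remove from the matching, and the requested left node. -/
abbrev ReqMove (α β : Type) := Finset (α × β) × α

/-- A Matcher strategy: maps each finite history of Requester moves to the set of
edges Matcher adds (a valid reply adds exactly one edge incident on the request). -/
abbrev Strategy (α β : Type) := List (ReqMove α β) → Finset (α × β)

/-- A Requester move in the ε-rich game: a set of left nodes whose requests are retracted
(all their matched edges are removed together), and the requested left node. -/
abbrev RReqMove (α : Type) := Finset α × α

/-- A Matcher strategy in the ε-rich game: maps each finite history of Requester moves
to the set of edges Matcher adds. -/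
abbrev RStrategy (α β : Type) := List (RReqMove α) → Finset (α × β)

variable {L R R₁ R₂ : Type} [DecidableEq L] [DecidableEq R] [DecidableEq R₁] [DecidableEq R₂]

/-- The set of neighbors of a set `S` of left nodes. -/
def NbrSet (Nbr : L → Finset R) (S : Finset L) : Finset R := S.biUnion Nbr

/-- The graph has `e`-expansion up to `K`: every left set `S` with `#S ≤ K`
has at least `e · #S` neighbors. -/
def Expansion (Nbr : L → Finset R) (e : ℚ) (K : ℕ) : Prop :=
  ∀ S : Finset L, S.card ≤ K → e * (S.card : ℚ) ≤ ((NbrSet Nbr S).card : ℚ)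

/-- The `ℓ`-clone of a graph: `ℓ` copies of the right set, with `x` adjacent to `(y, i)`
iff `x` is adjacent to `y` in the original graph. -/
def clone (ℓ : ℕ) (Nbr : L → Finset R) : L → Finset (R × Fin ℓ) :=
  fun x => (Nbr x) ×ˢ (Finset.univ : Finset (Fin ℓ))

/-- The product of two graphs with the same left set: `x` is adjacent to `(y₁, y₂)` iff
`x` is adjacent to `y₁` in the first graph and to `y₂` in the second graph. -/
def prodGraph (Nbr₁ : L → Finset R₁) (Nbr₂ : L → Finset R₂) : L → Finset (R₁ × R₂) :=
  fun x => (Nbr₁ x) ×ˢ (Nbr₂ x)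

/-- The private neighbors of a left set `S`: right nodes with exactly one neighbor in `S`. -/
def privNbrs [Fintype R] (Nbr : L → Finset R) (S : Finset L) : Finset R :=
  Finset.univ.filter fun y => (S.filter fun x => y ∈ Nbr x).card = 1

/-- The history of Requester moves after round `n` (i.e. the moves of rounds `0, …, n`). -/
def histUpTo (req : ℕ → ReqMove L R) (n : ℕ) : List (ReqMove L R) :=
  List.ofFn fun i : Fin (n + 1) => req i.1

/-- The matching `M` after round `n` of play: at round `n`, Requester removes the edges
`(req n).1` and requests `(req n).2`, then Matcher adds the edge(s) given by her strategy. -/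
def matchingAfter (σ : Strategy L R) (req : ℕ → ReqMove L R) : ℕ → Finset (L × R)
  | 0 => ∅
  | n + 1 => σ (histUpTo req n) ∪ (matchingAfter σ req n \ (req n).1)

/-- Requester's move at round `n` is legal: after his removal, `#M ≤ K - 1`. -/
def RemLegal (σ : Strategy L R) (K : ℕ) (req : ℕ → ReqMove L R) (n : ℕ) : Prop :=
  (matchingAfter σ req n \ (req n).1).card < K

/-- Matcher's reply at round `n` is valid for load `ℓ`: she adds exactly one edge of the
graph, incident on the requested node, and afterwards every right node is incident on
at most `ℓ` edges of `M`. -/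
def ValidReply (Nbr : L → Finset R) (ℓ : ℕ) (σ : Strategy L R)
    (req : ℕ → ReqMove L R) (n : ℕ) : Prop :=
  (∃ y ∈ Nbr (req n).2, σ (histUpTo req n) = {((req n).2, y)}) ∧
  ∀ y : R, ((matchingAfter σ req (n + 1)).filter fun p => p.2 = y).card ≤ ℓ

/-- The graph has dynamic matching up to `K` with load `ℓ`: Matcher has a strategy that
replies validly to every legal play of Requester. -/
def DynamicMatching (Nbr : L → Finset R) (K ℓ : ℕ) : Prop :=
  ∃ σ : Strategy L R, ∀ req : ℕ → ReqMove L R, ∀ n : ℕ,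
    (∀ i ≤ n, RemLegal σ K req i) → ValidReply Nbr ℓ σ req n

/-- Incremental matching up to `K` with load `ℓ`: Requester never removes edges,
and the game lasts at most `K` rounds. -/
def IncrementalMatching (Nbr : L → Finset R) (K ℓ : ℕ) : Prop :=
  ∃ σ : Strategy L R, ∀ req : ℕ → ReqMove L R, (∀ i, (req i).1 = ∅) →
    ∀ n < K, ValidReply Nbr ℓ σ req n

/-- Matching with `T` rounds up to `K` with load `ℓ`: the dynamic matching game is
terminated after `T` rounds. -/
def RoundMatching (Nbr : L → Finset R) (T K ℓ : ℕ) : Prop :=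
  ∃ σ : Strategy L R, ∀ req : ℕ → ReqMove L R, ∀ n < T,
    (∀ i ≤ n, RemLegal σ K req i) → ValidReply Nbr ℓ σ req n

/-- The edge Matcher added at round `i` is removed by Requester during one of the
rounds `i + 1, …, i + T`. -/
def ExpiredAt (σ : Strategy L R) (T : ℕ) (req : ℕ → ReqMove L R) (i : ℕ) : Prop :=
  ∃ j, i < j ∧ j ≤ i + T ∧ ∀ e ∈ σ (histUpTo req i), e ∈ (req j).1

/-- Matching up to `K` with `T`-expiration and load `ℓ`: the dynamic matching game in
which Requester must remove the edge added at round `i` during one of the rounds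
`i + 1, …, i + T`. -/
def ExpiringMatching (Nbr : L → Finset R) (T K ℓ : ℕ) : Prop :=
  ∃ σ : Strategy L R, ∀ req : ℕ → ReqMove L R, ∀ n : ℕ,
    (∀ i ≤ n, RemLegal σ K req i) → (∀ i, i + T ≤ n → ExpiredAt σ T req i) →
    ValidReply Nbr ℓ σ req n

/-! ### The ε-rich matching game

In the ε-rich game on a graph with left degree `D`, when Requester requests a left node
`x`, Matcher adds to `M` in one round a set of at least `(1 - ε) · D` edges incident on
`x`; when Requester retracts a request, all its edges are removed together. -/

/-- The history of rich-game Requester moves after round `n`. -/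
def rhistUpTo (req : ℕ → RReqMove L) (n : ℕ) : List (RReqMove L) :=
  List.ofFn fun i : Fin (n + 1) => req i.1

/-- The matching `M` after round `n` of the rich game: at round `n`, Requester retracts
the requests of the left nodes in `(req n).1` (removing all their edges) and requests
`(req n).2`, then Matcher adds the set of edges given by her strategy. -/
def rmatchingAfter (σ : RStrategy L R) (req : ℕ → RReqMove L) : ℕ → Finset (L × R)
  | 0 => ∅
  | n + 1 => σ (rhistUpTo req n) ∪
      ((rmatchingAfter σ req n).filter fun p => p.1 ∉ (req n).1)

/-- Requester's rich-game move at round `n` is legal: after the retraction, at most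
`K - 1` requests remain matched. -/
def RRemLegal (σ : RStrategy L R) (K : ℕ) (req : ℕ → RReqMove L) (n : ℕ) : Prop :=
  ((((rmatchingAfter σ req n).filter fun p => p.1 ∉ (req n).1)).image Prod.fst).card < K

/-- Matcher's rich reply at round `n` is valid for richness `ε` (relative to left degree
`D`) and load `ℓ`: she adds at least `(1 - ε) · D` edges of the graph, all incident on
the requested node, and afterwards every right node is incident on at most `ℓ` edges. -/
def RValidReply (Nbr : L → Finset R) (D : ℕ) (ε : ℚ) (ℓ : ℕ) (σ : RStrategy L R)
    (req : ℕ → RReqMove L) (n : ℕ) : Prop :=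
  (∀ e ∈ σ (rhistUpTo req n), e.1 = (req n).2 ∧ e.2 ∈ Nbr e.1) ∧
  (1 - ε) * (D : ℚ) ≤ ((σ (rhistUpTo req n)).card : ℚ) ∧
  ∀ y : R, ((rmatchingAfter σ req (n + 1)).filter fun p => p.2 = y).card ≤ ℓ

/-- ε-rich matching up to `K` with load `ℓ` (richness relative to left degree `D`). -/
def RichMatching (Nbr : L → Finset R) (D : ℕ) (ε : ℚ) (K ℓ : ℕ) : Prop :=
  ∃ σ : RStrategy L R, ∀ req : ℕ → RReqMove L, ∀ n : ℕ,
    (∀ i ≤ n, RRemLegal σ K req i) → RValidReply Nbr D ε ℓ σ req n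

/-- Incremental ε-rich matching up to `K` with load `ℓ`: Requester never retracts,
and the game lasts at most `K` rounds. -/
def RichIncrementalMatching (Nbr : L → Finset R) (D : ℕ) (ε : ℚ) (K ℓ : ℕ) : Prop :=
  ∃ σ : RStrategy L R, ∀ req : ℕ → RReqMove L, (∀ i, (req i).1 = ∅) →
    ∀ n < K, RValidReply Nbr D ε ℓ σ req n

/-- ε-rich matching up to `K` with `T`-expiration and load `ℓ`: Requester must retract
the request made at round `i` during one of the rounds `i + 1, …, i + T`. -/
def RichExpiringMatching (Nbr : L → Finset R) (D : ℕ) (ε : ℚ) (T K ℓ : ℕ) : Prop :=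
  ∃ σ : RStrategy L R, ∀ req : ℕ → RReqMove L, ∀ n : ℕ,
    (∀ i ≤ n, RRemLegal σ K req i) →
    (∀ i, i + T ≤ n → ∃ j, i < j ∧ j ≤ i + T ∧ (req i).2 ∈ (req j).1) →
    RValidReply Nbr D ε ℓ σ req n

end DM

open DM

namespace DM

section Strategy

variable {L R : Type}

lemma histUpTo_eq_append (req : ℕ → ReqMove L R) (n : ℕ) :
    histUpTo req n = (List.ofFn fun i : Fin n => req i) ++ [req n] := by
  rw [histUpTo, List.ofFn_succ', List.concat_eq_append]
  rfl

variable [DecidableEq L] [DecidableEq R]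

/-- The matching reached from `∅` when Matcher always answers with the edges `reply M m`,
where `M` is the current matching and `m` the last move of Requester. -/
def positionalRun (reply : Finset (L × R) → ReqMove L R → Finset (L × R))
    (h : List (ReqMove L R)) : Finset (L × R) :=
  h.foldl (fun M m => reply M m ∪ (M \ m.1)) ∅

/-- The strategy induced by a reply function depending only on the current matching and the
last move of Requester. -/
def positionalStrategy (reply : Finset (L × R) → ReqMove L R → Finset (L × R)) :
    Strategy L R :=
  fun h => match h.getLast? with
    | none => ∅
    | some m => reply (positionalRun reply h.dropLast) m

lemma matchingAfter_positionalStrategy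
    (reply : Finset (L × R) → ReqMove L R → Finset (L × R)) (req : ℕ → ReqMove L R) (n : ℕ) :
    matchingAfter (positionalStrategy reply) req n =
      positionalRun reply (List.ofFn fun i : Fin n => req i) := by
  induction n with
  | zero => simp [matchingAfter, positionalRun]
  | succ n ih =>
    have h := histUpTo_eq_append req n
    rw [matchingAfter, ih, h]
    rw [histUpTo] at h
    rw [h]
    simp [positionalStrategy, positionalRun]

lemma positionalStrategy_histUpTo
    (reply : Finset (L × R) → ReqMove L R → Finset (L × R)) (req : ℕ → ReqMove L R) (n : ℕ) :
    positionalStrategy reply (histUpTo req n) =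
      reply (matchingAfter (positionalStrategy reply) req n) (req n) := by
  rw [matchingAfter_positionalStrategy, histUpTo_eq_append]
  simp [positionalStrategy]

/-- Matcher wins if she can maintain an invariant of the matching that bounds the load. -/
theorem DynamicMatching.of_invariant {Nbr : L → Finset R} {K ℓ : ℕ}
    (Inv : Finset (L × R) → Prop) (h_empty : Inv ∅)
    (h_load : ∀ M, Inv M → ∀ y, (M.filter fun p => p.2 = y).card ≤ ℓ)
    (h_step : ∀ M D x, Inv M → (M \ D).card < K → ∃ y ∈ Nbr x, Inv ({(x, y)} ∪ (M \ D))) :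
    DynamicMatching Nbr K ℓ := by
  have h_reply : ∀ (M : Finset (L × R)) (m : ReqMove L R), ∃ E : Finset (L × R),
      Inv M → (M \ m.1).card < K →
        (∃ y ∈ Nbr m.2, E = {(m.2, y)}) ∧ Inv (E ∪ (M \ m.1)) := by
    intro M m
    by_cases h : Inv M ∧ (M \ m.1).card < K
    · obtain ⟨y, hy, hI⟩ := h_step M m.1 m.2 h.1 h.2
      exact ⟨{(m.2, y)}, fun _ _ => ⟨⟨y, hy, rfl⟩, hI⟩⟩
    · exact ⟨∅, fun h₁ h₂ => absurd ⟨h₁, h₂⟩ h⟩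
  choose reply hreply using h_reply
  refine ⟨positionalStrategy reply, fun req n hlegal => ?_⟩
  have h_inv : ∀ k ≤ n + 1, Inv (matchingAfter (positionalStrategy reply) req k) := by
    intro k
    induction k with
    | zero => exact fun _ => h_empty
    | succ k ih =>
      intro hk
      rw [matchingAfter, positionalStrategy_histUpTo]
      exact (hreply _ _ (ih (by omega)) (hlegal k (by omega))).2
  refine ⟨?_, h_load _ (h_inv (n + 1) le_rfl)⟩
  rw [positionalStrategy_histUpTo]
  exact (hreply _ _ (h_inv n (by omega)) (hlegal n le_rfl)).1

end Strategy

section Slack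

variable {L R : Type} [DecidableEq R]

/-- The number of edges that can still be attached to the set `A` of right nodes when every
right node has capacity `3`. -/
def slack (M : Finset (L × R)) (A : Finset R) : ℤ :=
  ∑ y ∈ A, (3 - ((M.filter fun p => p.2 = y).card : ℤ))

lemma slack_eq (M : Finset (L × R)) (A : Finset R) :
    slack M A = 3 * (A.card : ℤ) - ((M.filter fun p => p.2 ∈ A).card : ℤ) := by
  have h : (M.filter fun p => p.2 ∈ A).card =
      ∑ y ∈ A, (M.filter fun p => p.2 = y).card := by
    rw [Finset.card_eq_sum_card_fiberwise (f := Prod.snd) (t := A)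
      (fun p hp => by simpa using (Finset.mem_filter.mp hp).2)]
    refine Finset.sum_congr rfl fun y hy => congrArg _ ?_
    ext p
    simp only [Finset.mem_filter]
    constructor
    · rintro ⟨⟨h₁, -⟩, h₂⟩
      exact ⟨h₁, h₂⟩
    · rintro ⟨h₁, rfl⟩
      exact ⟨⟨h₁, hy⟩, rfl⟩
  rw [slack, h, Finset.sum_sub_distrib]
  push_cast
  simp [mul_comm]

lemma slack_mono {M : Finset (L × R)} (hM : ∀ y, (M.filter fun p => p.2 = y).card ≤ 3)
    {A B : Finset R} (h : A ⊆ B) : slack M A ≤ slack M B :=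
  Finset.sum_le_sum_of_subset_of_nonneg h fun y _ _ => by
    have := hM y
    omega

lemma slack_union_inter (M : Finset (L × R)) (A B : Finset R) :
    slack M (A ∪ B) + slack M (A ∩ B) = slack M A + slack M B :=
  Finset.sum_union_inter

lemma slack_insert [DecidableEq L] {M : Finset (L × R)} {x : L} {y : R} (h : (x, y) ∉ M) (A : Finset R) :
    slack (insert (x, y) M) A = slack M A - if y ∈ A then 1 else 0 := by
  rw [slack_eq, slack_eq, Finset.filter_insert]
  split_ifs with hy
  · rw [Finset.card_insert_of_notMem (by simp [h])]
    push_cast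
    ring
  · ring

/-- A matching of load at most `3` such that the unmatched left nodes still satisfy Hall's
condition up to `K` with respect to the remaining capacities. -/
structure Extendable (Nbr : L → Finset R) (K : ℕ) (M : Finset (L × R)) : Prop where
  mem_nbr : ∀ p ∈ M, p.2 ∈ Nbr p.1
  load_le : ∀ y, (M.filter fun p => p.2 = y).card ≤ 3
  card_le_slack : ∀ S : Finset L, S.card ≤ K → (∀ p ∈ M, p.1 ∉ S) →
    (S.card : ℤ) ≤ slack M (NbrSet Nbr S)

variable {Nbr : L → Finset R} {K : ℕ} {M : Finset (L × R)}

lemma Expansion.card_le (hexp : Expansion Nbr 1 K) {S : Finset L} (hS : S.card ≤ K) :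
    S.card ≤ (NbrSet Nbr S).card := by
  have := hexp S hS
  rw [one_mul] at this
  exact_mod_cast this

lemma extendable_empty (hexp : Expansion Nbr 1 K) : Extendable Nbr K ∅ where
  mem_nbr := by simp
  load_le := by simp
  card_le_slack S hS _ := by
    have := hexp.card_le hS
    rw [slack_eq]
    simp
    omega

/-- A set of unmatched left nodes whose neighborhood has no capacity to spare. -/
structure Tight (Nbr : L → Finset R) (K : ℕ) (M : Finset (L × R)) (S : Finset L) : Prop where
  card_le : S.card ≤ K
  free : ∀ p ∈ M, p.1 ∉ S
  slack_le : slack M (NbrSet Nbr S) ≤ S.card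

lemma Tight.two_mul_card_le (hexp : Expansion Nbr 1 K) {S : Finset L} (hS : Tight Nbr K M S) :
    2 * S.card ≤ M.card := by
  have h₁ := hexp.card_le hS.card_le
  have h₂ := hS.slack_le
  have h₃ := Finset.card_filter_le M fun p => p.2 ∈ NbrSet Nbr S
  rw [slack_eq] at h₂
  omega

variable [DecidableEq L]

lemma Extendable.mono (hM : Extendable Nbr K M) {M' : Finset (L × R)} (h : M' ⊆ M) :
    Extendable Nbr K M' where
  mem_nbr p hp := hM.mem_nbr p (h hp)
  load_le y := (Finset.card_le_card (Finset.filter_subset_filter _ h)).trans (hM.load_le y)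
  card_le_slack S hS hfree := by
    set U := S.filter fun x => ∀ p ∈ M, p.1 ≠ x with hU
    have hUS : U ⊆ S := Finset.filter_subset _ _
    have h₁ : (U.card : ℤ) ≤ slack M (NbrSet Nbr U) := by
      refine hM.card_le_slack U ((Finset.card_le_card hUS).trans hS) fun p hp hpU => ?_
      exact (Finset.mem_filter.mp hpU).2 p hp rfl
    have h₂ : slack M (NbrSet Nbr U) ≤ slack M (NbrSet Nbr S) :=
      slack_mono hM.load_le (Finset.biUnion_subset_biUnion_of_subset_left _ hUS)
    have h₃ : (S \ U).card ≤ ((M \ M').filter fun p => p.2 ∈ NbrSet Nbr S).card := by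
      refine (Finset.card_le_card fun x hx => ?_).trans
        (Finset.card_image_le (f := Prod.fst))
      obtain ⟨hxS, hxU⟩ := Finset.mem_sdiff.mp hx
      have : ∃ p ∈ M, p.1 = x := by
        by_contra! hne
        exact hxU (Finset.mem_filter.mpr ⟨hxS, hne⟩)
      obtain ⟨p, hp, rfl⟩ := this
      refine Finset.mem_image.mpr ⟨p, Finset.mem_filter.mpr
        ⟨Finset.mem_sdiff.mpr ⟨hp, fun hp' => hfree p hp' hxS⟩, ?_⟩, rfl⟩
      exact Finset.mem_biUnion.mpr ⟨p.1, hxS, hM.mem_nbr p hp⟩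
    have h₄ : (M.filter fun p => p.2 ∈ NbrSet Nbr S).card =
        ((M \ M').filter fun p => p.2 ∈ NbrSet Nbr S).card +
          (M'.filter fun p => p.2 ∈ NbrSet Nbr S).card := by
      rw [← Finset.card_union_of_disjoint
        (Finset.disjoint_filter_filter Finset.sdiff_disjoint), ← Finset.filter_union,
        Finset.sdiff_union_of_subset h]
    have h₅ := Finset.card_sdiff_add_card_eq_card hUS
    rw [slack_eq] at h₂ ⊢
    rw [slack_eq M (NbrSet Nbr S)] at h₂
    rw [slack_eq] at h₁
    omega

lemma Tight.union (hexp : Expansion Nbr 1 K) (hM : Extendable Nbr K M) (hcard : M.card < K)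
    {S T : Finset L} (hS : Tight Nbr K M S) (hT : Tight Nbr K M T) :
    Tight Nbr K M (S ∪ T) := by
  have h₁ := hS.two_mul_card_le hexp
  have h₂ := hT.two_mul_card_le hexp
  have h₃ := Finset.card_union_add_card_inter S T
  refine ⟨by omega, fun p hp => ?_, ?_⟩
  · simp [hS.free p hp, hT.free p hp]
  have h_inter := hM.card_le_slack (S ∩ T) (by omega)
    fun p hp hmem => hS.free p hp (Finset.mem_inter.mp hmem).1
  have h_le : slack M (NbrSet Nbr (S ∩ T)) ≤ slack M (NbrSet Nbr S ∩ NbrSet Nbr T) :=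
    slack_mono hM.load_le <| Finset.subset_inter
      (Finset.biUnion_subset_biUnion_of_subset_left _ Finset.inter_subset_left)
      (Finset.biUnion_subset_biUnion_of_subset_left _ Finset.inter_subset_right)
  have h_sum := slack_union_inter M (NbrSet Nbr S) (NbrSet Nbr T)
  have h_union : NbrSet Nbr (S ∪ T) = NbrSet Nbr S ∪ NbrSet Nbr T := Finset.union_biUnion
  have h₄ := hS.slack_le
  have h₅ := hT.slack_le
  rw [h_union]
  omega

/-- An extendable matching with fewer than `K` edges can be extended to any unmatched node. -/
lemma Extendable.exists_insert [Fintype L] (hexp : Expansion Nbr 1 K)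
    (hM : Extendable Nbr K M) (hcard : M.card < K) {x : L} (hx : ∀ p ∈ M, p.1 ≠ x) :
    ∃ y ∈ Nbr x, Extendable Nbr K (insert (x, y) M) := by
  classical
  obtain ⟨T, hT, hmax⟩ := Finset.exists_max_image
    (Finset.univ.filter fun S => Tight Nbr K M S ∧ x ∉ S) Finset.card
    ⟨∅, by simpa using (⟨by simp, by simp, by simp [NbrSet, slack]⟩ : Tight Nbr K M ∅)⟩
  obtain ⟨hT, hxT⟩ := (Finset.mem_filter.mp hT).2
  have h_sub : ∀ S, Tight Nbr K M S → x ∉ S → S ⊆ T := by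
    intro S hS hxS
    have h := hmax (S ∪ T) (by simp [hS.union hexp hM hcard hT, hxS, hxT])
    rw [Finset.eq_of_subset_of_card_le Finset.subset_union_right h]
    exact Finset.subset_union_left
  have h_hall : ((insert x T).card : ℤ) ≤ slack M (NbrSet Nbr (insert x T)) := by
    refine hM.card_le_slack _ ?_ fun p hp hmem => ?_
    · have := hT.two_mul_card_le hexp
      rw [Finset.card_insert_of_notMem hxT]
      omega
    · rcases Finset.mem_insert.mp hmem with h | h
      · exact hx p hp h
      · exact hT.free p hp h
  rw [Finset.card_insert_of_notMem hxT] at h_hall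
  have h_split : slack M (NbrSet Nbr (insert x T)) =
      slack M (Nbr x \ NbrSet Nbr T) + slack M (NbrSet Nbr T) := by
    rw [NbrSet, Finset.biUnion_insert, ← NbrSet, ← Finset.sdiff_union_self_eq_union]
    exact Finset.sum_union Finset.sdiff_disjoint
  have h_pos : 0 < slack M (Nbr x \ NbrSet Nbr T) := by
    have := hT.slack_le
    omega
  obtain ⟨y, hy, hy_pos⟩ : ∃ y ∈ Nbr x \ NbrSet Nbr T,
      0 < 3 - ((M.filter fun p => p.2 = y).card : ℤ) := by
    by_contra! h
    exact h_pos.not_ge (Finset.sum_nonpos h)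
  obtain ⟨hyx, hyT⟩ := Finset.mem_sdiff.mp hy
  have hxy : (x, y) ∉ M := fun h => hx _ h rfl
  refine ⟨y, hyx, ?_, fun z => ?_, fun S hS hfree => ?_⟩
  · intro p hp
    rcases Finset.mem_insert.mp hp with rfl | hp
    · exact hyx
    · exact hM.mem_nbr p hp
  · rw [Finset.filter_insert]
    split_ifs with hz
    · have h := Finset.card_insert_le (x, y) (M.filter fun p => p.2 = z)
      simp only at hz
      subst hz
      omega
    · exact hM.load_le z
  · have hxS : x ∉ S := hfree _ (Finset.mem_insert_self _ _)
    have hfree' : ∀ p ∈ M, p.1 ∉ S := fun p hp => hfree p (Finset.mem_insert_of_mem hp)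
    have h := hM.card_le_slack S hS hfree'
    rw [slack_insert hxy]
    split_ifs with hyS
    · by_contra! hlt
      refine hyT (Finset.biUnion_subset_biUnion_of_subset_left _
        (h_sub S ⟨hS, hfree', by omega⟩ hxS) hyS)
    · omega

end Slack

end DM

/-- If a bipartite graph has 1-expansion up to `K`, then it has dynamic
matching up to `K` with load 3. -/
theorem stmt3 (L R : Type) [Fintype L] [Fintype R] [DecidableEq L] [DecidableEq R]
    (Nbr : L → Finset R) (K : ℕ)
    (hexp : Expansion Nbr 1 K) :
    DynamicMatching Nbr K 3 := by
  refine DynamicMatching.of_invariant (Extendable Nbr K) (extendable_empty hexp)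
    (fun M hM => hM.load_le) fun M D x hM hcard => ?_
  have hMD := hM.mono (Finset.sdiff_subset (s := M) (t := D))
  by_cases hx : ∃ p ∈ M \ D, p.1 = x
  · obtain ⟨p, hp, rfl⟩ := hx
    refine ⟨p.2, hMD.mem_nbr p hp, ?_⟩
    rwa [← Finset.insert_eq, Finset.insert_eq_of_mem hp]
  · push Not at hx
    simpa only [← Finset.insert_eq] using hMD.exists_insert hexp hcard hx
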